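/- Let Π be a logic program and let lpopt(Π) be the program obtained by applying the lpopt rule-decomposition algorithm to every rule of Π. Then the answer sets of Π are preserved in the following sense: the map that removes from an interpretation all atoms over the fresh temporary and domain predicates introduced by lpopt is a bijection from the answer sets of lpopt(Π) onto the answer sets of Π; i.e., each answer set of lpopt(Π), after removal of all temporary atoms, coincides with exactly one answer set of Π, and every answer set of Π arises this way. -/

import Mathlib

/-! Basic syntax of (non-ground) logic programs: terms, atoms, rules,
grounding and the stable-model (answer-set) semantics. -/

/-- Variables. -/
abbrev Var : Type := ℕ
/-- Constants. -/
abbrev Cst : Type := ℕ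

/-- A term is a variable or a constant. -/
inductive Trm : Type where
  | var : Var → Trm
  | const : Cst → Trm
deriving DecidableEq

namespace Trm

def vars : Trm → Finset Var
  | var x => {x}
  | const _ => ∅

def consts : Trm → Finset Cst
  | var _ => ∅
  | const c => {c}

/-- Apply a (ground) substitution to a term. -/
def subst (s : Var → Cst) : Trm → Trm
  | var x => const (s x)
  | const c => const c

/-- Evaluate a term to a constant under a ground substitution. -/
def eval (s : Var → Cst) : Trm → Cst
  | var x => s x
  | const c => c

end Trm

/-- The set of variables of a list of terms. -/
def trmsVars (l : List Trm) : Finset Var := l.foldr (fun t s => t.vars ∪ s) ∅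

/-- The set of constants of a list of terms. -/
def trmsConsts (l : List Trm) : Finset Cst := l.foldr (fun t s => t.consts ∪ s) ∅

/-- An atom over the schema (set of predicate symbols) `P`. -/
structure Atm (P : Type) where
  pred : P
  args : List Trm
deriving DecidableEq

namespace Atm

variable {P : Type}

def vars (a : Atm P) : Finset Var := trmsVars a.args

def consts (a : Atm P) : Finset Cst := trmsConsts a.args

def subst (s : Var → Cst) (a : Atm P) : Atm P := ⟨a.pred, a.args.map (Trm.subst s)⟩

end Atm

/-- A logic programming rule: a disjunctive head, a positive body and a
negative body (sets of atoms; the negative body atoms are implicitly negated). -/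
structure Rule (P : Type) where
  head : Finset (Atm P)
  pos : Finset (Atm P)
  neg : Finset (Atm P)
deriving DecidableEq

namespace Rule

variable {P : Type} [DecidableEq P]

def atoms (r : Rule P) : Finset (Atm P) := r.head ∪ r.pos ∪ r.neg

def vars (r : Rule P) : Finset Var := r.atoms.sup Atm.vars

def consts (r : Rule P) : Finset Cst := r.atoms.sup Atm.consts

def headVars (r : Rule P) : Finset Var := r.head.sup Atm.vars

/-- A rule is safe if every variable occurs in the positive body. -/
def Safe (r : Rule P) : Prop := r.vars ⊆ r.pos.sup Atm.vars

def subst (s : Var → Cst) (r : Rule P) : Rule P :=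
  ⟨r.head.image (Atm.subst s), r.pos.image (Atm.subst s), r.neg.image (Atm.subst s)⟩

end Rule

section Semantics

variable {P : Type} [DecidableEq P]

/-- All ground instances of a rule w.r.t. a domain `D` of constants. -/
def groundInstances (D : Finset Cst) (r : Rule P) : Set (Rule P) :=
  { r' | ∃ s : Var → Cst, (∀ x, s x ∈ D) ∧ r' = r.subst s }

/-- The active domain of a program: all constants occurring in it. -/
def adom (Pgm : Finset (Rule P)) : Finset Cst := Pgm.sup Rule.consts

/-- The grounding of a program w.r.t. an explicit domain. -/
def groundProgD (D : Finset Cst) (Pgm : Finset (Rule P)) : Set (Rule P) :=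
  ⋃ r ∈ Pgm, groundInstances D r

/-- The grounding of a program (w.r.t. its active domain). -/
def groundProg (Pgm : Finset (Rule P)) : Set (Rule P) := groundProgD (adom Pgm) Pgm

/-- An interpretation `I` satisfies a ground rule. -/
def satisfies (I : Set (Atm P)) (r : Rule P) : Prop :=
  ((r.pos : Set (Atm P)) ⊆ I ∧ ∀ a ∈ r.neg, a ∉ I) → ∃ a ∈ r.head, a ∈ I

/-- `I` is a (classical) model of a set of ground rules. -/
def isModel (I : Set (Atm P)) (Q : Set (Rule P)) : Prop := ∀ r ∈ Q, satisfies I r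

/-- The Gelfond-Lifschitz reduct of a ground program w.r.t. `I`. -/
def reduct (Q : Set (Rule P)) (I : Set (Atm P)) : Set (Rule P) :=
  { r' | ∃ r ∈ Q, (∀ a ∈ r.neg, a ∉ I) ∧ r' = ⟨r.head, r.pos, ∅⟩ }

/-- `I` is a stable model (answer set) of a set of ground rules. -/
def isStable (I : Set (Atm P)) (Q : Set (Rule P)) : Prop :=
  isModel I (reduct Q I) ∧ ∀ J, J ⊂ I → ¬ isModel J (reduct Q I)

/-- The answer sets of a non-ground program. -/
def answerSets (Pgm : Finset (Rule P)) : Set (Set (Atm P)) :=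
  { I | isStable I (groundProg Pgm) }

/-- The answer sets of a non-ground program, grounding over an explicit domain. -/
def answerSetsD (D : Finset Cst) (Pgm : Finset (Rule P)) : Set (Set (Atm P)) :=
  { I | isStable I (groundProgD D Pgm) }

end Semantics
/-! Rooted trees and tree decompositions. -/

/-- A rooted tree on the node type `ι`, given by a parent function:
the root is its own parent, and every node reaches the root by
iterating the parent function. -/
structure RTree (ι : Type) where
  root : ι
  parent : ι → ι
  parent_root : parent root = root
  rootReach : ∀ n, ∃ k, parent^[k] n = root

namespace RTree

variable {ι : Type}

/-- `a` is an ancestor of `n` (possibly `a = n`). -/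
def Anc (T : RTree ι) (a n : ι) : Prop := ∃ k, T.parent^[k] n = a

/-- `s` lies on the (unique) path between `n` and `m`: it is an ancestor of
one of them, and every common ancestor of `n` and `m` is an ancestor of `s`. -/
def OnPath (T : RTree ι) (s n m : ι) : Prop :=
  (T.Anc s n ∨ T.Anc s m) ∧ ∀ a, T.Anc a n → T.Anc a m → T.Anc a s

end RTree

/-- A (rooted) tree decomposition of the graph `G`, covering the (finite)
vertex set `VS`: every vertex of `VS` occurs in some bag, every edge of `G`
is covered by some bag, and the bags containing a fixed vertex are connected
(closed under paths) in the tree. -/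
structure TreeDec (ι : Type) {α : Type} (G : SimpleGraph α) (VS : Finset α) where
  t : RTree ι
  bag : ι → Finset α
  covers_vertex : ∀ v ∈ VS, ∃ n, v ∈ bag n
  covers_edge : ∀ v w, G.Adj v w → ∃ n, v ∈ bag n ∧ w ∈ bag n
  connected : ∀ v, ∀ n m s : ι, v ∈ bag n → v ∈ bag m → t.OnPath s n m → v ∈ bag s

/-- The decomposition has width (at most) `k`: all bags have ≤ k+1 elements. -/
def TreeDec.HasWidth {ι α : Type} {G : SimpleGraph α} {VS : Finset α}
    (td : TreeDec ι G VS) (k : ℕ) : Prop :=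
  ∀ n, (td.bag n).card ≤ k + 1

/-- The width of a tree decomposition: maximal bag size minus one. -/
def TreeDec.width {ι α : Type} [Fintype ι] {G : SimpleGraph α} {VS : Finset α}
    (td : TreeDec ι G VS) : ℕ :=
  (Finset.univ.sup fun n => (td.bag n).card) - 1
/-- The Gaifman graph of a rule: vertices are the variables of the rule,
with an edge between two (distinct) variables iff they occur together in the
head or in a body atom of the rule. -/
def gaifman {P : Type} [DecidableEq P] (r : Rule P) : SimpleGraph Var :=
  SimpleGraph.fromRel fun x y =>
    (x ∈ r.headVars ∧ y ∈ r.headVars) ∨ ∃ a ∈ r.pos ∪ r.neg, x ∈ a.vars ∧ y ∈ a.vars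
/-! The lpopt rule decomposition algorithm. -/

/-- Predicates of the program produced by lpopt: the original predicates,
a fresh temporary predicate `temp r n` for each rule `r` and decomposition
node `n`, and a fresh domain predicate `dom r x` for each rule `r` and
variable `x`. -/
inductive LP (P ι : Type) where
  | base : P → LP P ι
  | temp : Rule P → ι → LP P ι
  | dom : Rule P → Var → LP P ι
deriving DecidableEq

/-- Lift an atom over `P` to an atom over the extended schema. -/
def Atm.lift {P ι : Type} (a : Atm P) : Atm (LP P ι) := ⟨LP.base a.pred, a.args⟩

/-- The list of variables of a finite set of variables, as terms. -/
def varsTerms (S : Finset Var) : List Trm := (S.sort (· ≤ ·)).map Trm.var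

section Lpopt

variable {P ι : Type} [DecidableEq P] [DecidableEq ι] [Fintype ι]

/-- The temporary atom `temp_n(Y_n)` for node `n`, where
`Y_n = χ(n) ∩ χ(parent n)`. -/
def tempAtm (r : Rule P) (td : TreeDec ι (gaifman r) r.vars) (n : ι) : Atm (LP P ι) :=
  ⟨LP.temp r n, varsTerms (td.bag n ∩ td.bag (td.t.parent n))⟩

/-- The domain atom `dom_x(x)`. -/
def domAtm (r : Rule P) (x : Var) : Atm (LP P ι) := ⟨LP.dom r x, [Trm.var x]⟩

/-- Variable `x` needs a domain predicate in the rule generated for a node with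
bag `B`: it occurs in a negative body atom with variables inside `B`, but in no
positive body atom with variables inside `B`. -/
def needsDomAt (r : Rule P) (B : Finset Var) (x : Var) : Prop :=
  (∃ a ∈ r.neg, a.vars ⊆ B ∧ x ∈ a.vars) ∧ ¬ ∃ b ∈ r.pos, b.vars ⊆ B ∧ x ∈ b.vars

open scoped Classical in
/-- Step 2 of lpopt: the rule generated for decomposition node `n`.  Its head
is the original head at the root and the temporary atom `temp_n(Y_n)`
otherwise; its body consists of all literals of the original rule whose
variables are inside the bag of `n`, the temporary atoms of the children of
`n`, and the required domain atoms. -/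
noncomputable def genRule (r : Rule P) (td : TreeDec ι (gaifman r) r.vars) (n : ι) :
    Rule (LP P ι) where
  head := if n = td.t.root then r.head.image Atm.lift else {tempAtm r td n}
  pos :=
    ((r.pos.filter fun a => a.vars ⊆ td.bag n).image Atm.lift)
    ∪ ((Finset.univ.filter fun m => td.t.parent m = n ∧ m ≠ td.t.root).image
        fun m => tempAtm r td m)
    ∪ ((r.vars.filter fun x => needsDomAt r (td.bag n) x).image fun x => domAtm r x)
  neg := (r.neg.filter fun a => a.vars ⊆ td.bag n).image Atm.lift

open scoped Classical in
/-- The variables of `r` for which a domain predicate is needed somewhere. -/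
noncomputable def domVars (r : Rule P) (td : TreeDec ι (gaifman r) r.vars) : Finset Var :=
  r.vars.filter fun x => ∃ n : ι, needsDomAt r (td.bag n) x

/-- Step 3 of lpopt: the domain rule `dom_x(x) ← a` for a chosen positive body
atom `a = dc x`. -/
def domRuleFor (r : Rule P) (dc : Var → Atm P) (x : Var) : Rule (LP P ι) :=
  ⟨{domAtm r x}, {Atm.lift (dc x)}, ∅⟩

/-- The set of rules lpopt produces from the single rule `r`. -/
noncomputable def lpoptRule (r : Rule P) (td : TreeDec ι (gaifman r) r.vars)
    (dc : Var → Atm P) : Finset (Rule (LP P ι)) :=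
  (Finset.univ.image fun n => genRule r td n)
  ∪ ((domVars r td).image fun x => domRuleFor r dc x)

/-- The program lpopt produces from the program `Pgm`, given for every rule a
tree decomposition of its Gaifman graph and a choice of atoms generating the
domain predicates. -/
noncomputable def lpoptProg (Pgm : Finset (Rule P))
    (td : (r : Rule P) → TreeDec ι (gaifman r) r.vars)
    (dc : Rule P → Var → Atm P) : Finset (Rule (LP P ι)) :=
  Pgm.biUnion fun r => lpoptRule r (td r) (dc r)

/-- Remove all atoms over the fresh (temporary and domain) predicates from an
interpretation, keeping the atoms over the original predicates. -/
def strip (I : Set (Atm (LP P ι))) : Set (Atm P) := { a | Atm.lift a ∈ I }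

end Lpopt
namespace RTree

variable {ι : Type} {T : RTree ι}

theorem Anc.refl (n : ι) : T.Anc n n := ⟨0, rfl⟩

theorem Anc.trans {a b c : ι} : T.Anc a b → T.Anc b c → T.Anc a c := by
  rintro ⟨k, rfl⟩ ⟨l, rfl⟩
  exact ⟨k + l, Function.iterate_add_apply _ _ _ _⟩

theorem anc_parent (n : ι) : T.Anc (T.parent n) n := ⟨1, rfl⟩

theorem anc_root (n : ι) : T.Anc T.root n := T.rootReach n

theorem Anc.eq_or_parent {a n : ι} : T.Anc a n → a = n ∨ T.Anc a (T.parent n) := by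
  rintro ⟨k, rfl⟩
  cases k with
  | zero => exact Or.inl rfl
  | succ k => exact Or.inr ⟨k, rfl⟩

theorem Anc.total {a b n : ι} : T.Anc a n → T.Anc b n → T.Anc a b ∨ T.Anc b a := by
  rintro ⟨k, rfl⟩ ⟨l, rfl⟩
  rcases le_total k l with h | h
  · obtain ⟨d, rfl⟩ := Nat.exists_eq_add_of_le' h
    exact Or.inr ⟨d, (Function.iterate_add_apply _ _ _ _).symm⟩
  · obtain ⟨d, rfl⟩ := Nat.exists_eq_add_of_le' h
    exact Or.inl ⟨d, (Function.iterate_add_apply _ _ _ _).symm⟩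

theorem eq_root_of_anc_parent {n : ι} : T.Anc n (T.parent n) → n = T.root := by
  rintro ⟨k, hk⟩
  have hp : Function.IsPeriodicPt T.parent (k + 1) n := hk
  obtain ⟨j, hj⟩ := T.rootReach n
  have h1 : T.parent^[(k + 1) * j] n = n := hp.mul_const j
  have h2 : T.parent^[k * j + j] n = T.root := by
    rw [Function.iterate_add_apply, hj]
    exact Function.iterate_fixed T.parent_root _
  rw [← h1, ← h2]
  ring_nf

/-- A node below `a` is `a` itself or lies below a child of `a`. -/
theorem Anc.eq_or_child {a n : ι} :
    T.Anc a n → n = a ∨ ∃ m, T.parent m = a ∧ m ≠ T.root ∧ T.Anc m n := by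
  rintro ⟨k, hk⟩
  induction k generalizing a with
  | zero => exact Or.inl hk
  | succ k ih =>
    rw [Function.iterate_succ_apply'] at hk
    by_cases h : T.parent^[k] n = T.root
    · rw [h, T.parent_root] at hk
      exact ih (h.trans hk)
    · exact Or.inr ⟨_, hk, h, k, rfl⟩

theorem child_unique {m m' n a : ι} (hm : T.parent m = n) (hm' : T.parent m' = n)
    (hr : m ≠ T.root) (hr' : m' ≠ T.root) (h : T.Anc m a) (h' : T.Anc m' a) : m = m' := by
  subst hm
  rcases h.total h' with h | h
  · refine h.eq_or_parent.resolve_right fun h => hr (eq_root_of_anc_parent ?_)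
    rwa [hm'] at h
  · refine (h.eq_or_parent.resolve_right fun h => hr' (eq_root_of_anc_parent ?_)).symm
    rw [hm']
    exact h

/-- The relation that `m` is a child of `n` is well-founded on a finite tree. -/
theorem wellFounded_child [Finite ι] (T : RTree ι) :
    WellFounded fun m n => T.parent m = n ∧ m ≠ T.root := by
  let R : ι → ι → Prop := fun m n => T.Anc n (T.parent m) ∧ m ≠ T.root
  have : IsTrans ι R := ⟨fun a b c h h' => ⟨(h'.1.trans (anc_parent b)).trans h.1, h.2⟩⟩
  have : Std.Irrefl R := ⟨fun a h => h.2 (eq_root_of_anc_parent h.1)⟩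
  exact Subrelation.wf (r := R) (fun h => ⟨h.1 ▸ Anc.refl _, h.2⟩)
    (Finite.wellFounded_of_trans_of_irrefl R)

end RTree

namespace TreeDec

variable {ι α : Type} {G : SimpleGraph α} {VS : Finset α}

/-- A vertex occurring both below `n` and not below `n` occurs in the bags of `n` and of its
parent. -/
theorem mem_bag_of_crossing (td : TreeDec ι G VS) {v : α} {n a b : ι}
    (ha : v ∈ td.bag a) (hna : td.t.Anc n a) (hb : v ∈ td.bag b) (hnb : ¬ td.t.Anc n b) :
    v ∈ td.bag n ∧ v ∈ td.bag (td.t.parent n) := by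
  have key : ∀ c, td.t.Anc c a → td.t.Anc c b → td.t.Anc c n := fun c hca hcb =>
    (hca.total hna).resolve_right fun h => hnb (h.trans hcb)
  refine ⟨td.connected v a b n ha hb ⟨Or.inl hna, key⟩,
    td.connected v a b _ ha hb ⟨Or.inl ((RTree.anc_parent n).trans hna), fun c hca hcb => ?_⟩⟩
  rcases (key c hca hcb).eq_or_parent with rfl | h
  · exact absurd hcb hnb
  · exact h

/-- Every clique is contained in a bag. -/
theorem exists_subset_bag [Finite ι] (td : TreeDec ι G VS) (S : Finset α) (hS : S ⊆ VS)
    (hadj : ∀ v ∈ S, ∀ w ∈ S, v ≠ w → G.Adj v w) : ∃ n, S ⊆ td.bag n := by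
  have hpair : ∀ v ∈ S, ∀ w ∈ S, ∃ n, v ∈ td.bag n ∧ w ∈ td.bag n := by
    intro v hv w hw
    by_cases h : v = w
    · subst h
      obtain ⟨n, hn⟩ := td.covers_vertex v (hS hv)
      exact ⟨n, hn, hn⟩
    · exact td.covers_edge v w (hadj v hv w hw h)
  obtain ⟨n, hn, hmin⟩ := td.t.wellFounded_child.has_min
    {n | ∀ v ∈ S, ∃ a, td.t.Anc n a ∧ v ∈ td.bag a}
    ⟨td.t.root, fun v hv => (td.covers_vertex v (hS hv)).imp fun a ha => ⟨RTree.anc_root a, ha⟩⟩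
  refine ⟨n, fun v hv => ?_⟩
  by_contra hvn
  obtain ⟨a, hna, hva⟩ := hn v hv
  rcases hna.eq_or_child with rfl | ⟨m, rfl, hmr, hma⟩
  · exact hvn hva
  refine hmin m (fun w hw => ?_) ⟨rfl, hmr⟩
  obtain ⟨b, hvb, hwb⟩ := hpair v hv w hw
  refine ⟨b, ?_, hwb⟩
  by_contra hmb
  exact hvn (td.mem_bag_of_crossing hva hma hvb hmb).2

end TreeDec

section Substitution

theorem mem_trmsVars {x : Var} {l : List Trm} : x ∈ trmsVars l ↔ ∃ t ∈ l, x ∈ t.vars := by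
  induction l with
  | nil => simp [trmsVars]
  | cons t l ih =>
    simp only [trmsVars, List.foldr_cons, Finset.mem_union, List.mem_cons] at ih ⊢
    rw [ih]
    simp

theorem Atm.subst_congr {P : Type} {a : Atm P} {s s' : Var → Cst}
    (h : ∀ x ∈ a.vars, s x = s' x) : a.subst s = a.subst s' := by
  simp only [Atm.subst, Atm.mk.injEq, true_and]
  refine List.map_congr_left fun t ht => ?_
  cases t with
  | const c => rfl
  | var x => simp [Trm.subst, h x (mem_trmsVars.2 ⟨_, ht, by simp [Trm.vars]⟩)]

theorem Atm.lift_subst {P ι : Type} (a : Atm P) (s : Var → Cst) :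
    (a.lift : Atm (LP P ι)).subst s = (a.subst s).lift := rfl

theorem Atm.lift_injective {P ι : Type} : Function.Injective (Atm.lift : Atm P → Atm (LP P ι)) := by
  rintro ⟨p, l⟩ ⟨q, m⟩ h
  simpa [Atm.lift] using h

theorem Atm.lift_consts {P ι : Type} (a : Atm P) : (a.lift : Atm (LP P ι)).consts = a.consts := rfl

theorem trmsConsts_map_var (l : List Var) : trmsConsts (l.map Trm.var) = ∅ := by
  induction l with
  | nil => rfl
  | cons x l ih =>
    exact (Finset.empty_union _).trans ih

theorem eqOn_of_varsTerms_map_subst_eq {S : Finset Var} {s s' : Var → Cst}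
    (h : (varsTerms S).map (Trm.subst s) = (varsTerms S).map (Trm.subst s')) :
    ∀ x ∈ S, s x = s' x := by
  intro x hx
  have := List.map_inj_left.1 h (Trm.var x) (by simpa [varsTerms] using hx)
  simpa [Trm.subst] using this

theorem mem_consts_rule {P : Type} [DecidableEq P] {r : Rule P} {c : Cst} :
    c ∈ r.consts ↔ ∃ a, (a ∈ r.head ∨ a ∈ r.pos ∨ a ∈ r.neg) ∧ c ∈ a.consts := by
  simp [Rule.consts, Rule.atoms, Finset.mem_sup]

theorem isModel_reduct_groundProg_iff {P : Type} [DecidableEq P] {Pgm : Finset (Rule P)}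
    {I J : Set (Atm P)} :
    isModel J (reduct (groundProg Pgm) I) ↔
      ∀ r ∈ Pgm, ∀ s : Var → Cst, (∀ x, s x ∈ adom Pgm) → (∀ a ∈ r.neg, a.subst s ∉ I) →
        (∀ a ∈ r.pos, a.subst s ∈ J) → ∃ a ∈ r.head, a.subst s ∈ J := by
  constructor
  · intro h r hr s hs hn hp
    have := h ⟨(r.subst s).head, (r.subst s).pos, ∅⟩ ⟨r.subst s, by
      simp only [groundProg, groundProgD, Set.mem_iUnion]
      exact ⟨r, hr, s, hs, rfl⟩, by simpa [Rule.subst] using hn, rfl⟩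
    obtain ⟨a, ha, haJ⟩ := this ⟨by
      intro a ha
      simp only [Rule.subst, Finset.coe_image, Set.mem_image, Finset.mem_coe] at ha
      obtain ⟨b, hb, rfl⟩ := ha
      exact hp b hb, by simp⟩
    simp only [Rule.subst, Finset.mem_image] at ha
    obtain ⟨b, hb, rfl⟩ := ha
    exact ⟨b, hb, haJ⟩
  · rintro h _ ⟨q, hq, hn, rfl⟩ ⟨hp, -⟩
    simp only [groundProg, groundProgD, Set.mem_iUnion] at hq
    obtain ⟨r, hr, s, hs, rfl⟩ := hq
    obtain ⟨a, ha, haJ⟩ := h r hr s hs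
      (fun a ha => hn _ (Finset.mem_image_of_mem _ ha))
      (fun a ha => hp (Finset.mem_coe.2 (Finset.mem_image_of_mem _ ha)))
    exact ⟨_, Finset.mem_image_of_mem _ ha, haJ⟩

end Substitution

section Decomposition

variable {P ι : Type} [DecidableEq P] [DecidableEq ι] [Fintype ι]

omit [DecidableEq ι] in
theorem exists_vars_subset_bag {r : Rule P} (td : TreeDec ι (gaifman r) r.vars) {a : Atm P}
    (ha : a ∈ r.pos ∪ r.neg) : ∃ n, a.vars ⊆ td.bag n := by
  refine td.exists_subset_bag a.vars ?_ fun v hv w hw hvw => ?_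
  · exact Finset.le_sup (f := Atm.vars) (by
      simp only [Rule.atoms, Finset.mem_union] at ha ⊢
      tauto)
  · exact (SimpleGraph.fromRel_adj _ _ _).2 ⟨hvw, Or.inl (Or.inr ⟨a, ha, hv, hw⟩)⟩

theorem forall_genRule_pos {r : Rule P} {td : TreeDec ι (gaifman r) r.vars} {n : ι}
    {p : Atm (LP P ι) → Prop} :
    (∀ a ∈ (genRule r td n).pos, p a) ↔
      (∀ a ∈ r.pos, a.vars ⊆ td.bag n → p a.lift) ∧
      (∀ m, td.t.parent m = n → m ≠ td.t.root → p (tempAtm r td m)) ∧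
      ∀ x ∈ r.vars, needsDomAt r (td.bag n) x → p (domAtm r x) := by
  simp only [genRule, Finset.forall_mem_union, Finset.forall_mem_image, Finset.mem_filter,
    Finset.mem_univ, true_and, and_imp, and_assoc]

theorem forall_genRule_neg {r : Rule P} {td : TreeDec ι (gaifman r) r.vars} {n : ι}
    {p : Atm (LP P ι) → Prop} :
    (∀ a ∈ (genRule r td n).neg, p a) ↔ ∀ a ∈ r.neg, a.vars ⊆ td.bag n → p a.lift := by
  simp only [genRule, Finset.forall_mem_image, Finset.mem_filter, and_imp]

theorem mem_lpoptProg {Pgm : Finset (Rule P)} {td : (r : Rule P) → TreeDec ι (gaifman r) r.vars}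
    {dc : Rule P → Var → Atm P} {q : Rule (LP P ι)} :
    q ∈ lpoptProg Pgm td dc ↔ ∃ r ∈ Pgm, (∃ n, genRule r (td r) n = q) ∨
      ∃ x ∈ domVars r (td r), domRuleFor r (dc r) x = q := by
  simp only [lpoptProg, lpoptRule, Finset.mem_biUnion, Finset.mem_union, Finset.mem_image,
    Finset.mem_univ, true_and]

theorem mem_adom {P : Type} [DecidableEq P] {Pgm : Finset (Rule P)} {c : Cst} :
    c ∈ adom Pgm ↔ ∃ r ∈ Pgm, ∃ a, (a ∈ r.head ∨ a ∈ r.pos ∨ a ∈ r.neg) ∧ c ∈ a.consts := by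
  simp only [adom, Finset.mem_sup, mem_consts_rule]

omit [DecidableEq ι] [Fintype ι] in
theorem tempAtm_consts (r : Rule P) (td : TreeDec ι (gaifman r) r.vars) (n : ι) :
    (tempAtm r td n).consts = ∅ := trmsConsts_map_var _

omit [DecidableEq P] [DecidableEq ι] [Fintype ι] in
theorem domAtm_consts (r : Rule P) (x : Var) : (domAtm r x : Atm (LP P ι)).consts = ∅ :=
  trmsConsts_map_var [x]

theorem adom_lpoptProg (Pgm : Finset (Rule P))
    (td : (r : Rule P) → TreeDec ι (gaifman r) r.vars) (dc : Rule P → Var → Atm P)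
    (hdc : ∀ r ∈ Pgm, ∀ x ∈ domVars r (td r), dc r x ∈ r.pos) :
    adom (lpoptProg Pgm td dc) = adom Pgm := by
  ext c
  rw [mem_adom, mem_adom]
  constructor
  · rintro ⟨q, hq, a, ha, hc⟩
    obtain ⟨r, hr, ⟨n, rfl⟩ | ⟨x, hx, rfl⟩⟩ := mem_lpoptProg.1 hq
    · refine ⟨r, hr, ?_⟩
      rcases ha with ha | ha | ha
      · simp only [genRule] at ha
        split_ifs at ha
        · obtain ⟨b, hb, rfl⟩ := Finset.mem_image.1 ha
          exact ⟨b, Or.inl hb, hc⟩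
        · rw [Finset.mem_singleton.1 ha, tempAtm_consts] at hc
          simp at hc
      · revert hc
        refine forall_genRule_pos
          (p := fun a => c ∈ a.consts → ∃ b, (b ∈ r.head ∨ b ∈ r.pos ∨ b ∈ r.neg) ∧ c ∈ b.consts)
          |>.2 ⟨fun b hb _ hc => ⟨b, Or.inr (Or.inl hb), hc⟩, fun m _ _ hc => ?_,
            fun x _ _ hc => ?_⟩ a ha
        · simp [tempAtm_consts] at hc
        · simp [domAtm_consts] at hc
      · revert hc
        exact forall_genRule_neg
          (p := fun a => c ∈ a.consts → ∃ b, (b ∈ r.head ∨ b ∈ r.pos ∨ b ∈ r.neg) ∧ c ∈ b.consts)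
          |>.2 (fun b hb _ hc => ⟨b, Or.inr (Or.inr hb), hc⟩) a ha
    · simp only [domRuleFor, Finset.mem_singleton, Finset.notMem_empty, or_false] at ha
      rcases ha with rfl | rfl
      · simp [domAtm_consts] at hc
      · exact ⟨r, hr, _, Or.inr (Or.inl (hdc r hr x hx)), hc⟩
  · rintro ⟨r, hr, a, ha, hc⟩
    have hgen : ∀ n, genRule r (td r) n ∈ lpoptProg Pgm td dc := fun n =>
      mem_lpoptProg.2 ⟨r, hr, Or.inl ⟨n, rfl⟩⟩
    rcases ha with ha | ha | ha
    · refine ⟨_, hgen (td r).t.root, a.lift, Or.inl ?_, hc⟩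
      simpa [genRule] using ⟨a, ha, rfl⟩
    · obtain ⟨n, hn⟩ := exists_vars_subset_bag (td r) (Finset.mem_union_left _ ha)
      exact ⟨_, hgen n, a.lift, Or.inr (Or.inl ((forall_genRule_pos (p := fun b => b ∈ _)).1
        (fun _ h => h) |>.1 a ha hn)), hc⟩
    · obtain ⟨n, hn⟩ := exists_vars_subset_bag (td r) (Finset.mem_union_right _ ha)
      exact ⟨_, hgen n, a.lift, Or.inr (Or.inr ((forall_genRule_neg (p := fun b => b ∈ _)).1
        (fun _ h => h) a ha hn)), hc⟩

/-- The substitution `s` makes all literals of `r` inside the bag of `n` true, where positive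
literals are evaluated in `A` and negative literals in `I`. -/
def BagHolds (A I : Set (Atm P)) (r : Rule P) (td : TreeDec ι (gaifman r) r.vars) (s : Var → Cst)
    (n : ι) : Prop :=
  (∀ a ∈ r.pos, a.vars ⊆ td.bag n → a.subst s ∈ A) ∧
    ∀ a ∈ r.neg, a.vars ⊆ td.bag n → a.subst s ∉ I

omit [DecidableEq ι] [Fintype ι] in
theorem BagHolds.congr {A I : Set (Atm P)} {r : Rule P} {td : TreeDec ι (gaifman r) r.vars}
    {s s' : Var → Cst} {n : ι} (h : BagHolds A I r td s n) (hs : ∀ x ∈ td.bag n, s x = s' x) :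
    BagHolds A I r td s' n :=
  ⟨fun a ha hn => Atm.subst_congr (fun x hx => hs x (hn hx)) ▸ h.1 a ha hn,
    fun a ha hn => Atm.subst_congr (fun x hx => hs x (hn hx)) ▸ h.2 a ha hn⟩

/-- Substitutions for the subtrees below the children of `n` that agree with a substitution for
`n` on the shared variables can be glued together. -/
theorem exists_glued_subst {A I : Set (Atm P)} {r : Rule P} {td : TreeDec ι (gaifman r) r.vars}
    {D : Finset Cst} {n : ι} {s : Var → Cst} (hs : ∀ x, s x ∈ D) (hn : BagHolds A I r td s n)
    (hch : ∀ m, td.t.parent m = n → m ≠ td.t.root → ∃ s' : Var → Cst, (∀ x, s' x ∈ D) ∧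
      (∀ x ∈ td.bag m ∩ td.bag n, s' x = s x) ∧ ∀ b, td.t.Anc m b → BagHolds A I r td s' b) :
    ∃ s' : Var → Cst, (∀ x, s' x ∈ D) ∧ (∀ x ∈ td.bag n, s' x = s x) ∧
      ∀ b, td.t.Anc n b → BagHolds A I r td s' b := by
  classical
  choose f hfD hfagree hfholds using hch
  let Q : Var → ι → Prop := fun x m =>
    ∃ b, td.t.parent m = n ∧ m ≠ td.t.root ∧ td.t.Anc m b ∧ x ∈ td.bag b
  let g : Var → Cst := fun x =>
    if h : x ∉ td.bag n ∧ ∃ m, Q x m then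
      f h.2.choose h.2.choose_spec.choose_spec.1 h.2.choose_spec.choose_spec.2.1 x
    else s x
  have hgn : ∀ x ∈ td.bag n, g x = s x := fun x hx => dif_neg fun h => h.1 hx
  refine ⟨g, fun x => ?_, hgn, fun b hb => ?_⟩
  · simp only [g]
    split_ifs
    · exact hfD _ _ _ _
    · exact hs x
  rcases hb.eq_or_child with rfl | ⟨m, hmn, hmr, hmb⟩
  · exact hn.congr fun x hx => (hgn x hx).symm
  refine (hfholds m hmn hmr b hmb).congr fun x hx => ?_
  by_cases hxn : x ∈ td.bag n
  · rw [hgn x hxn]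
    refine hfagree m hmn hmr x (Finset.mem_inter.2 ⟨?_, hxn⟩)
    refine (td.mem_bag_of_crossing hx hmb hxn fun h => hmr ?_).1
    exact RTree.eq_root_of_anc_parent (hmn.symm ▸ h)
  · have hQ : ∃ m, Q x m := ⟨m, b, hmn, hmr, hmb, hx⟩
    have hgx : g x = f hQ.choose hQ.choose_spec.choose_spec.1 hQ.choose_spec.choose_spec.2.1 x :=
      dif_pos ⟨hxn, hQ⟩
    have hm : hQ.choose = m := by
      obtain ⟨h1, h2, h3, h4⟩ := hQ.choose_spec.choose_spec
      by_contra hne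
      refine hxn (hmn ▸ (td.mem_bag_of_crossing hx hmb h4 fun h => hne ?_).2)
      exact RTree.child_unique h1 hmn h2 hmr h3 h
    rw [hgx]
    congr 1
    simp only [hm]

/-- The atoms derivable from the facts `A` by the rules of the lpopt program other than the root
rules, where negative literals are evaluated in `I`. -/
inductive Derivable (Pgm : Finset (Rule P)) (td : (r : Rule P) → TreeDec ι (gaifman r) r.vars)
    (dc : Rule P → Var → Atm P) (I A : Set (Atm P)) : Atm (LP P ι) → Prop
  | fact (a : Atm P) (ha : a ∈ A) : Derivable Pgm td dc I A a.lift
  | temp (r : Rule P) (hr : r ∈ Pgm) (n : ι) (hn : n ≠ (td r).t.root) (s : Var → Cst)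
      (hs : ∀ x, s x ∈ adom Pgm)
      (hneg : ∀ a ∈ r.neg, a.vars ⊆ (td r).bag n → a.subst s ∉ I)
      (hpos : ∀ a ∈ (genRule r (td r) n).pos, Derivable Pgm td dc I A (a.subst s)) :
      Derivable Pgm td dc I A ((tempAtm r (td r) n).subst s)
  | dom (r : Rule P) (hr : r ∈ Pgm) (x : Var) (hx : x ∈ domVars r (td r)) (s : Var → Cst)
      (hs : ∀ x, s x ∈ adom Pgm) (ha : (dc r x).subst s ∈ A) :
      Derivable Pgm td dc I A ((domAtm r x).subst s)

variable {Pgm : Finset (Rule P)} {td : (r : Rule P) → TreeDec ι (gaifman r) r.vars}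
  {dc : Rule P → Var → Atm P} {I A B : Set (Atm P)}

theorem derivable_lift_iff {a : Atm P} : Derivable Pgm td dc I A a.lift ↔ a ∈ A := by
  refine ⟨fun h => ?_, Derivable.fact a⟩
  generalize hb : (a.lift : Atm (LP P ι)) = b at h
  cases h with
  | fact c hc => exact Atm.lift_injective hb ▸ hc
  | temp => simp [Atm.lift, Atm.subst, tempAtm] at hb
  | dom => simp [Atm.lift, Atm.subst, domAtm] at hb

theorem strip_derivable : strip {a | Derivable Pgm td dc I A a} = A :=
  Set.ext fun _ => derivable_lift_iff

theorem Derivable.mono (hAB : A ⊆ B) {a : Atm (LP P ι)} (h : Derivable Pgm td dc I A a) :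
    Derivable Pgm td dc I B a := by
  induction h with
  | fact a ha => exact .fact a (hAB ha)
  | temp r hr n hn s hs hneg _ ih => exact .temp r hr n hn s hs hneg ih
  | dom r hr x hx s hs ha => exact .dom r hr x hx s hs (hAB ha)

/-- A derivable temporary atom is witnessed by a substitution satisfying all literals of the
subtree. -/
theorem Derivable.exists_subst {r : Rule P} {n : ι} {s : Var → Cst}
    (h : Derivable Pgm td dc I A ((tempAtm r (td r) n).subst s)) :
    ∃ s' : Var → Cst, (∀ x, s' x ∈ adom Pgm) ∧
      (∀ x ∈ (td r).bag n ∩ (td r).bag ((td r).t.parent n), s' x = s x) ∧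
      ∀ b, (td r).t.Anc n b → BagHolds A I r (td r) s' b := by
  generalize hb : (tempAtm r (td r) n).subst s = b at h
  induction h generalizing r n s with
  | fact => simp [Atm.lift, Atm.subst, tempAtm] at hb
  | dom => simp [domAtm, Atm.subst, tempAtm] at hb
  | temp r' hr n' hn s₁ hs hneg hpos ih =>
    obtain ⟨⟨rfl, rfl⟩, hb⟩ : (r = r' ∧ n = n') ∧ _ := by
      simpa only [Atm.subst, tempAtm, Atm.mk.injEq, LP.temp.injEq] using hb
    rw [forall_genRule_pos] at hpos ih
    obtain ⟨s', hs', hagree, hholds⟩ := exists_glued_subst (A := A) (I := I) hs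
      ⟨fun a ha hn => derivable_lift_iff.1 (hpos.1 a ha hn), hneg⟩
      fun m hm hmr => by simpa only [hm] using ih.2.1 m hm hmr rfl
    refine ⟨s', hs', fun x hx => ?_, hholds⟩
    rw [hagree x (Finset.mem_inter.1 hx).1]
    exact (eqOn_of_varsTerms_map_subst_eq hb x hx).symm

section Models

variable (hdc : ∀ r ∈ Pgm, ∀ x ∈ domVars r (td r), dc r x ∈ r.pos)
include hdc

/-- The reduct of the lpopt program, spelled out. -/
theorem isModel_reduct_lpoptProg_iff {I' J : Set (Atm (LP P ι))} :
    isModel J (reduct (groundProg (lpoptProg Pgm td dc)) I') ↔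
      ∀ r ∈ Pgm, ∀ s : Var → Cst, (∀ x, s x ∈ adom Pgm) →
        (∀ n, (∀ a ∈ r.neg, a.vars ⊆ (td r).bag n → a.subst s ∉ strip I') →
          (∀ a ∈ (genRule r (td r) n).pos, a.subst s ∈ J) →
          ∃ a ∈ (genRule r (td r) n).head, a.subst s ∈ J) ∧
        ∀ x ∈ domVars r (td r), (dc r x).subst s ∈ strip J → (domAtm r x).subst s ∈ J := by
  rw [isModel_reduct_groundProg_iff, adom_lpoptProg Pgm td dc hdc]
  constructor
  · intro h r hr s hs
    refine ⟨fun n hneg hpos => ?_, fun x hx ha => ?_⟩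
    · exact h _ (mem_lpoptProg.2 ⟨r, hr, Or.inl ⟨n, rfl⟩⟩) s hs (forall_genRule_neg.2 hneg) hpos
    · have := h _ (mem_lpoptProg.2 ⟨r, hr, Or.inr ⟨x, hx, rfl⟩⟩) s hs
        (by simp [domRuleFor]) fun a h => Finset.mem_singleton.1 h ▸ ha
      simpa [domRuleFor] using this
  · intro h q hq s hs hneg hpos
    obtain ⟨r, hr, ⟨n, rfl⟩ | ⟨x, hx, rfl⟩⟩ := mem_lpoptProg.1 hq
    · exact (h r hr s hs).1 n (forall_genRule_neg.1 hneg) hpos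
    · have := (h r hr s hs).2 x hx (hpos (dc r x).lift (by simp [domRuleFor]))
      simpa [domRuleFor] using this

theorem Derivable.mem_of_isModel {I' J : Set (Atm (LP P ι))}
    (hJ : isModel J (reduct (groundProg (lpoptProg Pgm td dc)) I')) {a : Atm (LP P ι)}
    (h : Derivable Pgm td dc (strip I') (strip J) a) : a ∈ J := by
  rw [isModel_reduct_lpoptProg_iff hdc] at hJ
  induction h with
  | fact a ha => exact ha
  | temp r hr n hn s hs hneg _ ih =>
    have := (hJ r hr s hs).1 n hneg ih
    simpa [genRule, hn] using this
  | dom r hr x hx s hs ha => exact (hJ r hr s hs).2 x hx ha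

/-- Models of the lpopt program restrict to models of the original program. -/
theorem isModel_strip {I' J : Set (Atm (LP P ι))}
    (hJ : isModel J (reduct (groundProg (lpoptProg Pgm td dc)) I')) :
    isModel (strip J) (reduct (groundProg Pgm) (strip I')) := by
  rw [isModel_reduct_lpoptProg_iff hdc] at hJ
  rw [isModel_reduct_groundProg_iff]
  intro r hr s hs hneg hpos
  have hbody : ∀ n, (∀ m, (td r).t.parent m = n → m ≠ (td r).t.root →
      (tempAtm r (td r) m).subst s ∈ J) → ∃ a ∈ (genRule r (td r) n).head, a.subst s ∈ J := by
    refine fun n hm => (hJ r hr s hs).1 n (fun a ha _ => hneg a ha)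
      (forall_genRule_pos.2 ⟨fun a ha _ => hpos a ha, hm, fun x hx hxn => ?_⟩)
    have hxd : x ∈ domVars r (td r) := by
      simpa only [domVars, Finset.mem_filter] using ⟨hx, n, hxn⟩
    exact (hJ r hr s hs).2 x hxd (hpos _ (hdc r hr x hxd))
  have htemp : ∀ m, m ≠ (td r).t.root → (tempAtm r (td r) m).subst s ∈ J := by
    intro m
    induction m using (td r).t.wellFounded_child.induction with
    | _ m ih =>
      intro hm
      have := hbody m fun k hk hkr => ih k ⟨hk, hkr⟩ hkr
      simpa [genRule, hm] using this
  obtain ⟨_, ha, haJ⟩ := hbody (td r).t.root fun m _ hm => htemp m hm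
  simp only [genRule, if_true, Finset.mem_image] at ha
  obtain ⟨a, ha, rfl⟩ := ha
  exact ⟨a, ha, haJ⟩

/-- Models of the original program extend to models of the lpopt program. -/
theorem isModel_derivable (hroot : ∀ r ∈ Pgm, r.headVars ⊆ (td r).bag (td r).t.root)
    {I' : Set (Atm (LP P ι))} (hA : isModel A (reduct (groundProg Pgm) (strip I'))) :
    isModel {a | Derivable Pgm td dc (strip I') A a}
      (reduct (groundProg (lpoptProg Pgm td dc)) I') := by
  rw [isModel_reduct_groundProg_iff] at hA
  rw [isModel_reduct_lpoptProg_iff hdc, strip_derivable]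
  intro r hr s hs
  refine ⟨fun n hneg hpos => ?_, fun x hx ha => .dom r hr x hx s hs ha⟩
  by_cases hn : n = (td r).t.root
  · rw [forall_genRule_pos] at hpos
    obtain ⟨s', hs', hagree, hholds⟩ := exists_glued_subst (A := A) (I := strip I') hs
      ⟨fun a ha hn => derivable_lift_iff.1 (hpos.1 a ha hn), hneg⟩
      fun m hm hmr => by simpa only [hm] using (hpos.2.1 m hm hmr).exists_subst
    have hall : ∀ b, BagHolds A (strip I') r (td r) s' b := fun b =>
      hholds b (hn ▸ RTree.anc_root b)
    obtain ⟨a, ha, haA⟩ := hA r hr s' hs'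
      (fun a ha => by
        obtain ⟨b, hb⟩ := exists_vars_subset_bag (td r) (Finset.mem_union_right _ ha)
        exact (hall b).2 a ha hb)
      (fun a ha => by
        obtain ⟨b, hb⟩ := exists_vars_subset_bag (td r) (Finset.mem_union_left _ ha)
        exact (hall b).1 a ha hb)
    refine ⟨a.lift, by simpa [genRule, hn] using ⟨a, ha, rfl⟩,
      .fact (a.subst s) ?_⟩
    rwa [← Atm.subst_congr fun x hx => hagree x
      (hn ▸ hroot r hr (Finset.le_sup (f := Atm.vars) ha hx))]
  · refine ⟨tempAtm r (td r) n, by simp [genRule, hn], .temp r hr n hn s hs hneg hpos⟩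

theorem eq_derivable_of_isStable (hroot : ∀ r ∈ Pgm, r.headVars ⊆ (td r).bag (td r).t.root)
    {I' : Set (Atm (LP P ι))} (h : I' ∈ answerSets (lpoptProg Pgm td dc)) :
    {a | Derivable Pgm td dc (strip I') (strip I') a} = I' := by
  by_contra hne
  exact h.2 _ (LE.le.ssubset_of_ne (fun _ ha => ha.mem_of_isModel hdc h.1) hne)
    (isModel_derivable hdc hroot (isModel_strip hdc h.1))

end Models

end Decomposition

/-- **Theorem (lpopt preserves answer sets).**
Let `Pgm` be a program (of safe rules) and `lpoptProg Pgm td dc` the program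
obtained by applying the lpopt rule decomposition to every rule of `Pgm`
(using, for each rule, a tree decomposition of its Gaifman graph whose root
bag contains all head variables, and a choice `dc` of positive body atoms
defining the domain predicates).  Then the map removing all atoms over the
fresh temporary and domain predicates is a bijection from the answer sets of
`lpoptProg Pgm td dc` onto the answer sets of `Pgm`. -/
theorem lpopt_preserves_answer_sets
    {P ι : Type} [DecidableEq P] [DecidableEq ι] [Fintype ι]
    (Pgm : Finset (Rule P))
    (hsafe : ∀ r ∈ Pgm, r.Safe)
    (td : (r : Rule P) → TreeDec ι (gaifman r) r.vars)
    (hroot : ∀ r ∈ Pgm, r.headVars ⊆ (td r).bag (td r).t.root)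
    (dc : Rule P → Var → Atm P)
    (hdc : ∀ r ∈ Pgm, ∀ x ∈ domVars r (td r), dc r x ∈ r.pos ∧ x ∈ (dc r x).vars) :
    Set.BijOn strip (answerSets (lpoptProg Pgm td dc)) (answerSets Pgm) := by
  have hdc' : ∀ r ∈ Pgm, ∀ x ∈ domVars r (td r), dc r x ∈ r.pos := fun r hr x hx =>
    (hdc r hr x hx).1
  refine ⟨fun I' hI' => ⟨isModel_strip hdc' hI'.1, fun A hA hmod => ?_⟩, fun I' hI' J' hJ' h => ?_,
    fun I hI => ⟨{a | Derivable Pgm td dc I I a}, ⟨?_, fun J hJ hmod => ?_⟩, strip_derivable⟩⟩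
  · refine hI'.2 _ ?_ (isModel_derivable hdc' hroot hmod)
    have heq := eq_derivable_of_isStable hdc' hroot hI'
    refine LE.le.ssubset_of_ne (fun a ha => heq ▸ Derivable.mono hA.1 ha) fun h => ?_
    exact hA.ne (by rw [← h, strip_derivable])
  · rw [← eq_derivable_of_isStable hdc' hroot hI', ← eq_derivable_of_isStable hdc' hroot hJ', h]
  · have := isModel_derivable (I' := {a | Derivable Pgm td dc I I a}) (A := I) hdc' hroot
      (by rw [strip_derivable]; exact hI.1)
    rwa [strip_derivable] at this
  · have hstrip := isModel_strip hdc' hmod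
    rw [strip_derivable] at hstrip
    have hsub : strip J ⊆ I := fun a ha => derivable_lift_iff.1 (hJ.1 ha)
    have heq : strip J = I := by
      by_contra hne
      exact hI.2 _ (hsub.ssubset_of_ne hne) hstrip
    refine hJ.2 fun a ha => Derivable.mem_of_isModel hdc' hmod ?_
    rw [strip_derivable, heq]
    exact ha
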